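/- arXiv:2202.06812 — 2 statements merged into one kernel-verified Lean document; each statement's English description precedes it below -/
import Mathlib

section
/- Let H be finite-dimensional and T : L(H) → L(H) a completely positive trace-preserving map with a full-rank fixed point density matrix. Then the fixed-point set F_{T*} = {X ∈ L(H) : T*(X) = X} of the unital dual map T* is a von Neumann subalgebra of L(H) (i.e., it is closed under multiplication and adjoints, and contains the identity). -/
open Matrix
open scoped ComplexOrder

/-- Stack a family of square blocks into a column. -/
def stackCol {n : Type*} {k : ℕ} (W : Fin k → Matrix n n ℂ) : Matrix (n × Fin k) n ℂ :=
  Matrix.of fun p j => W p.2 p.1 j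

theorem eq_of_trace_mul {n : Type*} [Fintype n] [DecidableEq n] {A B : Matrix n n ℂ}
    (h : ∀ Y, (Aᴴ * Y).trace = (Bᴴ * Y).trace) : A = B := by
  have h0 : ((A - B)ᴴ * (A - B)).trace = 0 := by
    rw [conjTranspose_sub, Matrix.sub_mul, Matrix.trace_sub, h, sub_self]
  exact sub_eq_zero.1 (Matrix.trace_conjTranspose_mul_self_eq_zero_iff.1 h0)

theorem stack_posSemidef {n : Type*} [Fintype n] [DecidableEq n]
    (T : Matrix n n ℂ →ₗ[ℂ] Matrix n n ℂ)
    (hCP : ∀ (k : ℕ) (M : Matrix (n × Fin k) (n × Fin k) ℂ), M.PosSemidef →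
      (Matrix.of fun (p q : n × Fin k) =>
        T (Matrix.of fun (i j : n) => M (i, p.2) (j, q.2)) p.1 q.1).PosSemidef)
    {k : ℕ} (W : Fin k → Matrix n n ℂ) (Y : Matrix n n ℂ) (hY : Y.PosSemidef) :
    (Matrix.of fun (p q : n × Fin k) =>
        T (W p.2 * Y * (W q.2)ᴴ) p.1 q.1).PosSemidef := by
  have h := hCP k _ (hY.mul_mul_conjTranspose_same (stackCol W))
  exact h

theorem T_conj {n : Type*} [Fintype n] [DecidableEq n]
    (T : Matrix n n ℂ →ₗ[ℂ] Matrix n n ℂ)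
    (hCP : ∀ (k : ℕ) (M : Matrix (n × Fin k) (n × Fin k) ℂ), M.PosSemidef →
      (Matrix.of fun (p q : n × Fin k) =>
        T (Matrix.of fun (i j : n) => M (i, p.2) (j, q.2)) p.1 q.1).PosSemidef)
    (Y : Matrix n n ℂ) : T Yᴴ = (T Y)ᴴ := by
  have h := (stack_posSemidef T hCP ![Y, 1] 1 Matrix.PosSemidef.one).isHermitian
  ext i j
  have := congrFun (congrFun h (i, 1)) (j, 0)
  simp [Matrix.conjTranspose_apply] at this
  simp [Matrix.conjTranspose_apply, this]

theorem schwarz_trace {n : Type*} [Fintype n] [DecidableEq n]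
    (T : Matrix n n ℂ →ₗ[ℂ] Matrix n n ℂ)
    (hCP : ∀ (k : ℕ) (M : Matrix (n × Fin k) (n × Fin k) ℂ), M.PosSemidef →
      (Matrix.of fun (p q : n × Fin k) =>
        T (Matrix.of fun (i j : n) => M (i, p.2) (j, q.2)) p.1 q.1).PosSemidef)
    (hTP : ∀ X, (T X).trace = X.trace) (X : Matrix n n ℂ)
    (h1 : ∀ Y, (X * T Y).trace = (X * Y).trace)
    (h2 : ∀ Y, (Xᴴ * T Y).trace = (Xᴴ * Y).trace)
    (Y : Matrix n n ℂ) (hY : Y.PosSemidef) :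
    0 ≤ (Xᴴ * X * T Y).trace - (Xᴴ * X * Y).trace := by
  have h := ((stack_posSemidef T hCP ![1, X] Y hY).conjTranspose_mul_mul_same
    (stackCol ![Xᴴ, -1])).trace_nonneg
  have e : ∀ V W : Fin 2 → Matrix n n ℂ, (stackCol V)ᴴ * (Matrix.of fun (p q : n × Fin 2) =>
        T (W p.2 * Y * (W q.2)ᴴ) p.1 q.1) * stackCol V
      = ∑ b, ∑ a, (V a)ᴴ * T (W a * Y * (W b)ᴴ) * V b := by
    intro V W
    ext i j
    simp only [Matrix.mul_apply, Matrix.sum_apply, Fintype.sum_prod_type, stackCol, Matrix.of_apply,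
      Matrix.conjTranspose_apply, Matrix.add_apply, Fin.sum_univ_two, Finset.sum_add_distrib, add_mul]
  rw [e] at h
  simp only [Fin.sum_univ_two, Matrix.cons_val_zero, Matrix.cons_val_one, Matrix.trace_add,
    conjTranspose_conjTranspose, conjTranspose_neg, conjTranspose_one, Matrix.one_mul,
    Matrix.mul_one, Matrix.neg_mul, Matrix.mul_neg, neg_neg, Matrix.trace_neg, hTP, h1] at h
  have e1 : (X * T Y * Xᴴ).trace = (Xᴴ * X * T Y).trace := by
    rw [Matrix.trace_mul_comm, Matrix.mul_assoc]
  have e2 : (T (X * Y) * Xᴴ).trace = (Xᴴ * X * Y).trace := by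
    rw [Matrix.trace_mul_comm, h2, Matrix.mul_assoc]
  have e3 : (X * (Y * Xᴴ)).trace = (Xᴴ * X * Y).trace := by
    rw [← Matrix.mul_assoc, Matrix.trace_mul_comm, Matrix.mul_assoc]
  have e4 : (X * Y * Xᴴ).trace = (Xᴴ * X * Y).trace := by
    rw [Matrix.trace_mul_comm, Matrix.mul_assoc]
  rw [e1, e2, e3, e4] at h
  convert h using 1
  ring

open scoped MatrixOrder Matrix.Norms.L2Operator in
theorem exists_factor {n : Type*} [Fintype n] [DecidableEq n] {D : Matrix n n ℂ}
    (hD : D.PosSemidef) : ∃ B : Matrix n n ℂ, D = Bᴴ * B :=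
  CStarAlgebra.nonneg_iff_eq_star_mul_self.mp hD.nonneg

theorem eq_zero_of_trace {n : Type*} [Fintype n] [DecidableEq n] (D ρ : Matrix n n ℂ)
    (hD : D.IsHermitian) (hpos : ∀ Y : Matrix n n ℂ, Y.PosSemidef → 0 ≤ (D * Y).trace)
    (hρ : ρ.PosDef) (h0 : (D * ρ).trace = 0) : D = 0 := by
  have hP : D.PosSemidef := by
    refine Matrix.PosSemidef.of_dotProduct_mulVec_nonneg hD fun v => ?_
    have := hpos _ (Matrix.posSemidef_vecMulVec_self_star v)
    rwa [Matrix.mul_vecMulVec, Matrix.trace_vecMulVec, dotProduct_comm] at this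
  obtain ⟨B, rfl⟩ := exists_factor hP
  have h1 : (B * ρ * Bᴴ).trace = 0 := by
    rw [Matrix.trace_mul_comm, ← Matrix.mul_assoc, h0]
  have h2 := (hρ.posSemidef.mul_mul_conjTranspose_same B).trace_eq_zero_iff.1 h1
  have h3 : Bᴴ = 0 := by
    apply Matrix.ext_of_mulVec_single
    intro j
    rw [Matrix.zero_mulVec]
    by_contra hne
    have := hρ.dotProduct_mulVec_pos hne
    rw [Matrix.star_mulVec, conjTranspose_conjTranspose, ← Matrix.dotProduct_mulVec,
      Matrix.mulVec_mulVec, Matrix.mulVec_mulVec, h2] at this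
    simp at this
  rw [h3, Matrix.zero_mul]

/-- Lindblad: if `T` is a completely positive trace-preserving map on `L(H)` (finite
dimension) with a full-rank fixed point, then the fixed-point set of the unital dual
map `T*` (w.r.t. the Hilbert–Schmidt inner product) is a von Neumann subalgebra:
it contains the identity and is closed under adjoints and multiplication. -/
theorem stmt_10 {n : Type*} [Fintype n] [DecidableEq n]
    (T S : Matrix n n ℂ →ₗ[ℂ] Matrix n n ℂ)
    (hCP : ∀ (k : ℕ) (M : Matrix (n × Fin k) (n × Fin k) ℂ), M.PosSemidef →
      (Matrix.of fun (p q : n × Fin k) =>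
        T (Matrix.of fun (i j : n) => M (i, p.2) (j, q.2)) p.1 q.1).PosSemidef)
    (hTP : ∀ X, (T X).trace = X.trace)
    (hfix : ∃ ρ : Matrix n n ℂ, ρ.PosDef ∧ T ρ = ρ)
    (hadj : ∀ X Y : Matrix n n ℂ, ((S X)ᴴ * Y).trace = (Xᴴ * T Y).trace) :
    S 1 = 1 ∧ (∀ X, S X = X → S Xᴴ = Xᴴ) ∧
      ∀ X Y, S X = X → S Y = Y → S (X * Y) = X * Y := by
  obtain ⟨ρ, hρ, hTρ⟩ := hfix
  have hSc : ∀ X, S Xᴴ = (S X)ᴴ := by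
    intro X
    apply eq_of_trace_mul
    intro Y
    rw [hadj, conjTranspose_conjTranspose, conjTranspose_conjTranspose]
    have h := congrArg star (hadj X Yᴴ)
    rw [← Matrix.trace_conjTranspose, ← Matrix.trace_conjTranspose, T_conj T hCP] at h
    simp only [conjTranspose_mul, conjTranspose_conjTranspose] at h
    rw [Matrix.trace_mul_comm X, ← h, Matrix.trace_mul_comm]
  have key : ∀ X, S X = X → S (Xᴴ * X) = Xᴴ * X := by
    intro X hX
    have hXc : S Xᴴ = Xᴴ := by rw [hSc, hX]
    have hH : (S (Xᴴ * X) - Xᴴ * X).IsHermitian := by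
      unfold Matrix.IsHermitian
      rw [conjTranspose_sub, ← hSc]
      simp
    have hD : ∀ Y, ((S (Xᴴ * X) - Xᴴ * X) * Y).trace
        = (Xᴴ * X * T Y).trace - (Xᴴ * X * Y).trace := by
      intro Y
      have h := hadj (Xᴴ * X) Y
      rw [← hSc] at h
      simp only [conjTranspose_mul, conjTranspose_conjTranspose] at h
      rw [Matrix.sub_mul, Matrix.trace_sub, h]
    refine sub_eq_zero.1 (eq_zero_of_trace _ ρ hH (fun Y hY => ?_) hρ ?_)
    · rw [hD]
      refine schwarz_trace T hCP hTP X (fun Y => ?_) (fun Y => ?_) Y hY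
      · have := hadj Xᴴ Y
        rw [hXc, conjTranspose_conjTranspose] at this
        exact this.symm
      · have := hadj X Y
        rw [hX] at this
        exact this.symm
    · rw [hD, hTρ, sub_self]
  refine ⟨?_, ?_, ?_⟩
  · apply eq_of_trace_mul
    intro Y
    rw [hadj]
    simp [hTP]
  · intro X hX
    rw [hSc, hX]
  · intro X Y hX hY
    have hXc : S Xᴴ = Xᴴ := by rw [hSc, hX]
    have k1 := key (Xᴴ + Y) (by rw [map_add, hXc, hY])
    have k2 := key (Xᴴ + Complex.I • Y) (by rw [map_add, map_smul, hXc, hY])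
    have kx := key _ hXc
    have ky := key _ hY
    simp only [conjTranspose_add, conjTranspose_smul, conjTranspose_conjTranspose, Matrix.add_mul,
      Matrix.mul_add, map_add, map_smul, Matrix.smul_mul, Matrix.mul_smul] at k1 k2 kx ky
    rw [kx, ky] at k1 k2
    have c1 : S (X * Y) + S (Yᴴ * Xᴴ) = X * Y + Yᴴ * Xᴴ := by
      linear_combination (norm := module) k1
    have c2 : S (X * Y) - S (Yᴴ * Xᴴ) = X * Y - Yᴴ * Xᴴ := by
      have hs : star Complex.I = -Complex.I := Complex.conj_I
      rw [hs] at k2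
      have : Complex.I • (S (X * Y) - S (Yᴴ * Xᴴ)) = Complex.I • (X * Y - Yᴴ * Xᴴ) := by
        simp only [smul_sub, neg_smul] at k2 ⊢
        linear_combination (norm := module) k2
      exact smul_right_injective _ Complex.I_ne_zero this
    have c3 : (2 : ℂ) • S (X * Y) = (2 : ℂ) • (X * Y) := by
      rw [two_smul, two_smul]
      linear_combination (norm := module) c1 + c2
    exact smul_right_injective _ (two_ne_zero) c3
end

section
/- Let H, H_E be finite-dimensional and K ∈ L(H). Suppose that for the atomic algebra A = ⊕_{i∈I} L(H_{A_i}) ⊗ 1_{B_i} ⊆ L(H) (with null block H_0), the map L(X) = −K†X − XK satisfies L(A) ⊆ A. Then K = K_A + iH' + P_0†K_0 where K_A ∈ A, H' is a self-adjoint element of the commutant A′, and K_0 ∈ L(H; H_0), P_0 being the coisometry onto H_0. -/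
open Matrix Kronecker

theorem block_aux {A B : Type*} [Fintype A] [Fintype B] [DecidableEq A] [DecidableEq B]
    (k : Matrix (A × B) (A × B) ℂ)
    (hk : ∀ X : Matrix A A ℂ, ∃ X' : Matrix A A ℂ,
      -(kᴴ * (X ⊗ₖ (1 : Matrix B B ℂ))) - (X ⊗ₖ (1 : Matrix B B ℂ)) * k = X' ⊗ₖ (1 : Matrix B B ℂ)) :
    ∃ (a : Matrix A A ℂ) (h : Matrix (A × B) (A × B) ℂ), hᴴ = h ∧
      (∀ X : Matrix A A ℂ, h * (X ⊗ₖ (1 : Matrix B B ℂ)) = (X ⊗ₖ (1 : Matrix B B ℂ)) * h) ∧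
      k = a ⊗ₖ (1 : Matrix B B ℂ) + Complex.I • h := by
  rcases isEmpty_or_nonempty A with hA | ⟨⟨a0⟩⟩
  · exact ⟨0, 0, Subsingleton.elim _ _, fun X => Subsingleton.elim _ _, Subsingleton.elim _ _⟩
  obtain ⟨s, hs⟩ := hk 1
  rw [one_kronecker_one, mul_one, one_mul] at hs
  have hkk : kᴴ = (-s) ⊗ₖ (1 : Matrix B B ℂ) - k := by
    have : (-s) ⊗ₖ (1 : Matrix B B ℂ) = - (s ⊗ₖ (1 : Matrix B B ℂ)) := by
      ext; simp [kroneckerMap_apply]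
    rw [this, ← hs]; abel
  have hcm : ∀ X : Matrix A A ℂ, ∃ Z : Matrix A A ℂ,
      (X ⊗ₖ (1 : Matrix B B ℂ)) * k - k * (X ⊗ₖ (1 : Matrix B B ℂ)) = Z ⊗ₖ (1 : Matrix B B ℂ) := by
    intro X
    obtain ⟨X', hX'⟩ := hk X
    refine ⟨-(X' - s * X), ?_⟩
    have e : (-(X' - s * X)) ⊗ₖ (1 : Matrix B B ℂ)
        = -(X' ⊗ₖ (1 : Matrix B B ℂ)) - ((-s) * X) ⊗ₖ ((1 : Matrix B B ℂ) * 1) := by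
      ext; simp [kroneckerMap_apply]; ring
    rw [e, mul_kronecker_mul, ← hX', hkk]
    noncomm_ring
  choose Z hZ using hcm
  let m : Matrix B B ℂ := fun y y' => k (a0, y) (a0, y')
  let al : Matrix A A ℂ := fun x x' => Z (Matrix.single a0 x 1) a0 x'
  let M : Matrix (A × B) (A × B) ℂ := (1 : Matrix A A ℂ) ⊗ₖ m
  have hM : k = al ⊗ₖ (1 : Matrix B B ℂ) + M := by
    ext ⟨x, y⟩ ⟨x', y'⟩
    have := congrFun (congrFun (hZ (Matrix.single a0 x 1)) (a0, y)) (x', y')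
    simp only [Matrix.sub_apply, Matrix.mul_apply, kroneckerMap_apply, Fintype.sum_prod_type,
      Matrix.single_apply, Matrix.one_apply] at this
    rw [Matrix.add_apply, kroneckerMap_apply, Matrix.one_apply]
    change _ = Z (Matrix.single a0 x 1) a0 x' * _ + (1 : Matrix A A ℂ) x x' * k (a0, y) (a0, y')
    rw [← this, Matrix.one_apply]
    by_cases hx : x = x' <;> simp [hx, ite_and]
  have hMH : Mᴴ = (1 : Matrix A A ℂ) ⊗ₖ mᴴ := by
    simp [M, conjTranspose_kronecker]
  have hsum : M + Mᴴ = (-s - al - alᴴ) ⊗ₖ (1 : Matrix B B ℂ) := by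
    have e : (-s - al - alᴴ) ⊗ₖ (1 : Matrix B B ℂ)
        = (-s) ⊗ₖ (1 : Matrix B B ℂ) - al ⊗ₖ (1 : Matrix B B ℂ) - alᴴ ⊗ₖ (1 : Matrix B B ℂ) := by
      ext; simp [kroneckerMap_apply]; ring
    have h2 : kᴴ = alᴴ ⊗ₖ (1 : Matrix B B ℂ) + Mᴴ := by
      rw [hM, conjTranspose_add, conjTranspose_kronecker, conjTranspose_one]
    have h3 : Mᴴ = kᴴ - alᴴ ⊗ₖ (1 : Matrix B B ℂ) := by rw [h2]; abel
    have h4 : M = k - al ⊗ₖ (1 : Matrix B B ℂ) := by rw [hM]; abel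
    rw [e, h3, hkk, h4]; abel
  refine ⟨al + (1/2 : ℂ) • (-s - al - alᴴ), (-Complex.I/2) • (M - Mᴴ), ?_, ?_, ?_⟩
  · rw [conjTranspose_smul, conjTranspose_sub, conjTranspose_conjTranspose]
    rw [← neg_sub M, smul_neg, ← neg_smul]
    congr 1
    simp [neg_div]
  · intro X
    rw [smul_mul_assoc, mul_smul_comm, sub_mul, mul_sub, hMH]
    simp only [M, ← mul_kronecker_mul, one_mul, mul_one]
  · rw [add_kronecker, smul_kronecker, ← hsum, smul_smul]
    conv_lhs => rw [hM]
    have : Complex.I * (-Complex.I/2) = 1/2 := by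
      rw [mul_div_assoc', mul_neg, Complex.I_mul_I]; norm_num
    rw [this, add_assoc, ← smul_add]
    congr 1
    have : M + Mᴴ + (M - Mᴴ) = (2:ℂ) • M := by rw [two_smul]; abel
    rw [this, smul_smul]; norm_num

/-- If `L(X) = −K†X − XK` leaves the atomic algebra `𝒜 = ⊕ᵢ L(H_{Aᵢ}) ⊗ 1_{Bᵢ}`
(with null block `H₀`) invariant, then `K = K_𝒜 + iH' + P₀†K₀` with `K_𝒜 ∈ 𝒜`,
`H'` a self-adjoint element of the commutant `𝒜′`, and `K₀ ∈ L(H; H₀)`. -/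
theorem stmt_18 {I H0 H : Type*} [Fintype I] [DecidableEq I]
    [Fintype H0] [DecidableEq H0] [Fintype H] [DecidableEq H]
    {Ai Bi : I → Type*} [∀ i, Fintype (Ai i)] [∀ i, Fintype (Bi i)]
    [∀ i, DecidableEq (Ai i)] [∀ i, DecidableEq (Bi i)]
    (P0 : Matrix H0 H ℂ) (P : ∀ i, Matrix (Ai i × Bi i) H ℂ)
    (hP0 : P0 * P0ᴴ = 1)
    (hPi : ∀ i, P i * (P i)ᴴ = 1)
    (hP0i : ∀ i, P0 * (P i)ᴴ = 0)
    (hPij : ∀ i j, i ≠ j → P i * (P j)ᴴ = 0)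
    (hcomp : P0ᴴ * P0 + ∑ i, (P i)ᴴ * P i = 1)
    (K : Matrix H H ℂ)
    (hinv : ∀ XA : (∀ i, Matrix (Ai i) (Ai i) ℂ),
      ∃ XA' : (∀ i, Matrix (Ai i) (Ai i) ℂ),
        -(Kᴴ * (∑ i, (P i)ᴴ * (XA i ⊗ₖ (1 : Matrix (Bi i) (Bi i) ℂ)) * P i)) -
          (∑ i, (P i)ᴴ * (XA i ⊗ₖ (1 : Matrix (Bi i) (Bi i) ℂ)) * P i) * K =
        ∑ i, (P i)ᴴ * (XA' i ⊗ₖ (1 : Matrix (Bi i) (Bi i) ℂ)) * P i) :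
    ∃ (KA : ∀ i, Matrix (Ai i) (Ai i) ℂ) (H' : Matrix H H ℂ) (K0 : Matrix H0 H ℂ),
      H'ᴴ = H' ∧
      (∀ XA : (∀ i, Matrix (Ai i) (Ai i) ℂ),
          H' * (∑ i, (P i)ᴴ * (XA i ⊗ₖ (1 : Matrix (Bi i) (Bi i) ℂ)) * P i) =
          (∑ i, (P i)ᴴ * (XA i ⊗ₖ (1 : Matrix (Bi i) (Bi i) ℂ)) * P i) * H') ∧
      K = (∑ i, (P i)ᴴ * (KA i ⊗ₖ (1 : Matrix (Bi i) (Bi i) ℂ)) * P i) +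
          Complex.I • H' + P0ᴴ * K0 := by
  have key : ∀ (F : ∀ i, Matrix (Ai i × Bi i) (Ai i × Bi i) ℂ) i,
      P i * (∑ j, (P j)ᴴ * F j * P j) = F i * P i := by
    intro F i
    rw [Matrix.mul_sum, Finset.sum_eq_single i]
    · rw [← Matrix.mul_assoc, ← Matrix.mul_assoc, hPi, Matrix.one_mul]
    · intro j _ hj
      rw [← Matrix.mul_assoc, ← Matrix.mul_assoc, hPij i j hj.symm, Matrix.zero_mul, Matrix.zero_mul]
    · simp
  have key2 : ∀ (F : ∀ i, Matrix (Ai i × Bi i) (Ai i × Bi i) ℂ) i,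
      (∑ j, (P j)ᴴ * F j * P j) * (P i)ᴴ = (P i)ᴴ * F i := by
    intro F i
    rw [Matrix.sum_mul, Finset.sum_eq_single i]
    · rw [Matrix.mul_assoc, hPi, Matrix.mul_one]
    · intro j _ hj
      rw [Matrix.mul_assoc, hPij j i hj, Matrix.mul_zero]
    · simp
  have hblock : ∀ i, ∀ X : Matrix (Ai i) (Ai i) ℂ, ∃ X' : Matrix (Ai i) (Ai i) ℂ,
      -((P i * K * (P i)ᴴ)ᴴ * (X ⊗ₖ (1 : Matrix (Bi i) (Bi i) ℂ)))
        - (X ⊗ₖ (1 : Matrix (Bi i) (Bi i) ℂ)) * (P i * K * (P i)ᴴ)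
        = X' ⊗ₖ (1 : Matrix (Bi i) (Bi i) ℂ) := by
    intro i X
    obtain ⟨X', h⟩ := hinv (Pi.single i X)
    refine ⟨X' i, ?_⟩
    have h1 := congrArg (fun T => P i * T * (P i)ᴴ) h
    simp only [Matrix.mul_sub, Matrix.sub_mul, Matrix.mul_neg, Matrix.neg_mul] at h1
    rw [key, Matrix.mul_assoc (P i) (Kᴴ * _), Matrix.mul_assoc Kᴴ, key2, ← Matrix.mul_assoc (P i) _ K, key, Matrix.mul_assoc _ (P i) (P i)ᴴ, hPi, Matrix.mul_one,
      Pi.single_eq_same] at h1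
    rw [← h1]
    simp only [conjTranspose_mul, conjTranspose_conjTranspose, Matrix.mul_assoc]
  have hrow : ∀ i, P i * K = (P i * K * (P i)ᴴ) * P i := by
    intro i
    have hK : ∃ Q : Matrix (Ai i × Bi i) (Ai i × Bi i) ℂ, P i * K = Q * P i := by
      obtain ⟨X'', h⟩ := hinv (Pi.single i 1)
      have h1 := congrArg (fun T => P i * T) h
      have hs : (∑ j, (P j)ᴴ * ((Pi.single i 1 : ∀ i, Matrix (Ai i) (Ai i) ℂ) j ⊗ₖ (1 : Matrix (Bi j) (Bi j) ℂ)) * P j)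
          = (P i)ᴴ * P i := by
        rw [Finset.sum_eq_single i]
        · rw [Pi.single_eq_same, one_kronecker_one, Matrix.mul_one]
        · intro j _ hj
          rw [Pi.single_eq_of_ne hj, zero_kronecker, Matrix.mul_zero, Matrix.zero_mul]
        · simp
      simp only [hs] at h1
      rw [key, Matrix.mul_sub, ← Matrix.mul_assoc (P i) _ K, ← Matrix.mul_assoc (P i), hPi, Matrix.one_mul] at h1
      refine ⟨-(P i * Kᴴ * (P i)ᴴ) - X'' i ⊗ₖ (1 : Matrix (Bi i) (Bi i) ℂ), ?_⟩
      rw [Matrix.sub_mul, ← h1]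
      simp only [Matrix.neg_mul, Matrix.mul_neg, Matrix.mul_assoc]
      abel
    obtain ⟨Q, hQ⟩ := hK
    rw [hQ, Matrix.mul_assoc Q, hPi, Matrix.mul_one]
  choose a h hh hc hk using fun i => block_aux (P i * K * (P i)ᴴ) (hblock i)
  refine ⟨a, ∑ i, (P i)ᴴ * h i * P i, P0 * K, ?_, ?_, ?_⟩
  · rw [conjTranspose_sum]
    refine Finset.sum_congr rfl fun i _ => ?_
    rw [conjTranspose_mul, conjTranspose_mul, conjTranspose_conjTranspose, hh, Matrix.mul_assoc]
  · intro XA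
    rw [Matrix.sum_mul, Matrix.sum_mul]
    refine Finset.sum_congr rfl fun i _ => ?_
    rw [Matrix.mul_assoc, key, Matrix.mul_assoc _ (P i), key, ← Matrix.mul_assoc, ← Matrix.mul_assoc, Matrix.mul_assoc _ (h i), hc,
      ← Matrix.mul_assoc]
  · have e : K = P0ᴴ * (P0 * K) + ∑ i, (P i)ᴴ * (P i * K) := by
      conv_lhs => rw [← Matrix.one_mul K, ← hcomp, Matrix.add_mul, Matrix.sum_mul]
      simp only [Matrix.mul_assoc]
    conv_lhs => rw [e]
    rw [add_comm, Finset.smul_sum, ← Finset.sum_add_distrib]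
    congr 1
    refine Finset.sum_congr rfl fun i _ => ?_
    rw [hrow i, hk i]
    simp only [Matrix.add_mul, Matrix.mul_add, Matrix.smul_mul, Matrix.mul_smul, Matrix.mul_assoc]
end
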